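/- arXiv:2003.09252 — 5 statements merged into one kernel-verified Lean document; each statement's English description precedes it below -/
import Mathlib

section
/- Let the strong stability hypotheses hold: for every λ ∈ ℂ with Re λ ≥ 0 the matrices λE − A0 − Σ_{i=1}^m A_i e^{−λτ_i} and Uᵀ A0 V + Σ_{i=1}^m Uᵀ A_i V e^{−λτ_i} are invertible, and sup_{Re λ ≥ 0} ‖(Uᵀ A0 V + Σ_{i=1}^m Uᵀ A_i V e^{−λτ_i})^{−1}‖ < ∞. Then for every γ > 0 there exists Ω > 0 such that σ1(T(jω, τ) − T_a(jω, τ)) < γ for all ω > Ω. -/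
open Matrix

/-- largest singular value (= L2 operator norm) of a complex matrix. -/
noncomputable def sigma1 {p q : ℕ} (M : Matrix (Fin p) (Fin q) ℂ) : ℝ :=
  ‖LinearMap.toContinuousLinearMap (Matrix.toEuclideanLin M)‖

/-- characteristic matrix λE − A0 − Σ_i A_i e^{−λ r_i}. -/
noncomputable def Delta {n m : ℕ} (E A0 : Matrix (Fin n) (Fin n) ℝ)
    (A : Fin m → Matrix (Fin n) (Fin n) ℝ) (r : Fin m → ℝ) (lam : ℂ) :
    Matrix (Fin n) (Fin n) ℂ :=
  lam • E.map Complex.ofReal - A0.map Complex.ofReal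
    - ∑ i, Complex.exp (-lam * (r i : ℂ)) • (A i).map Complex.ofReal

/-- transfer function T(λ, r) = C (λE − A0 − Σ A_i e^{−λ r_i})⁻¹ B. -/
noncomputable def Ttf {n m n_w n_z : ℕ} (E A0 : Matrix (Fin n) (Fin n) ℝ)
    (A : Fin m → Matrix (Fin n) (Fin n) ℝ)
    (B : Matrix (Fin n) (Fin n_w) ℝ) (C : Matrix (Fin n_z) (Fin n) ℝ)
    (r : Fin m → ℝ) (lam : ℂ) : Matrix (Fin n_z) (Fin n_w) ℂ :=
  C.map Complex.ofReal * (Delta E A0 A r lam)⁻¹ * B.map Complex.ofReal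

/-- Uᵀ A0 V + Σ_i Uᵀ A_i V e^{−λ r_i}. -/
noncomputable def DeltaA {n m ν : ℕ} (A0 : Matrix (Fin n) (Fin n) ℝ)
    (A : Fin m → Matrix (Fin n) (Fin n) ℝ)
    (U V : Matrix (Fin n) (Fin ν) ℝ) (r : Fin m → ℝ) (lam : ℂ) :
    Matrix (Fin ν) (Fin ν) ℂ :=
  (Uᵀ * A0 * V).map Complex.ofReal
    + ∑ i, Complex.exp (-lam * (r i : ℂ)) • (Uᵀ * A i * V).map Complex.ofReal

/-- asymptotic transfer function T_a(λ, r) = −CV (Uᵀ A0 V + Σ Uᵀ A_i V e^{−λ r_i})⁻¹ Uᵀ B. -/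
noncomputable def Ta {n m ν n_w n_z : ℕ} (A0 : Matrix (Fin n) (Fin n) ℝ)
    (A : Fin m → Matrix (Fin n) (Fin n) ℝ)
    (B : Matrix (Fin n) (Fin n_w) ℝ) (C : Matrix (Fin n_z) (Fin n) ℝ)
    (U V : Matrix (Fin n) (Fin ν) ℝ) (r : Fin m → ℝ) (lam : ℂ) :
    Matrix (Fin n_z) (Fin n_w) ℂ :=
  -((C * V).map Complex.ofReal * (DeltaA A0 A U V r lam)⁻¹ * (Uᵀ * B).map Complex.ofReal)

/-- Uᵀ A0 V + Σ_i Uᵀ A_i V e^{−jθ_i}. -/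
noncomputable def ABar {n m ν : ℕ} (A0 : Matrix (Fin n) (Fin n) ℝ)
    (A : Fin m → Matrix (Fin n) (Fin n) ℝ)
    (U V : Matrix (Fin n) (Fin ν) ℝ) (θ : Fin m → ℝ) :
    Matrix (Fin ν) (Fin ν) ℂ :=
  (Uᵀ * A0 * V).map Complex.ofReal
    + ∑ i, Complex.exp (-Complex.I * (θ i : ℂ)) • (Uᵀ * A i * V).map Complex.ofReal

/-- 𝕋_a(θ) = −CV (Uᵀ A0 V + Σ Uᵀ A_i V e^{−jθ_i})⁻¹ Uᵀ B. -/
noncomputable def TaBar {n m ν n_w n_z : ℕ} (A0 : Matrix (Fin n) (Fin n) ℝ)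
    (A : Fin m → Matrix (Fin n) (Fin n) ℝ)
    (B : Matrix (Fin n) (Fin n_w) ℝ) (C : Matrix (Fin n_z) (Fin n) ℝ)
    (U V : Matrix (Fin n) (Fin ν) ℝ) (θ : Fin m → ℝ) :
    Matrix (Fin n_z) (Fin n_w) ℂ :=
  -((C * V).map Complex.ofReal * (ABar A0 A U V θ)⁻¹ * (Uᵀ * B).map Complex.ofReal)

/-- strong H∞-type value: lim_{ε→0+} (i.e. inf over ε > 0, by monotonicity) of
    sup { H r : r in the open Euclidean ball B(τ, ε) with all components positive }. -/
noncomputable def strongVal {m : ℕ} (H : (Fin m → ℝ) → ℝ) (τ : Fin m → ℝ) : ℝ :=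
  ⨅ ε : {e : ℝ // 0 < e},
    sSup {x : ℝ | ∃ r : Fin m → ℝ,
      (∑ i, (r i - τ i) ^ 2) < (ε : ℝ) ^ 2 ∧ (∀ i, 0 < r i) ∧ x = H r}

/-- ξ is a singular value of M: ξ ≥ 0 and ξ² is an eigenvalue of MᴴM. -/
def IsSingularValue {p q : ℕ} (M : Matrix (Fin p) (Fin q) ℂ) (ξ : ℝ) : Prop :=
  0 ≤ ξ ∧ ∃ v : Fin q → ℂ, v ≠ 0 ∧ (Mᴴ * M) *ᵥ v = ((ξ : ℂ) ^ 2) • v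

section helpers
open scoped Matrix.Norms.L2Operator

lemma sigma1_eq {p q : ℕ} (M : Matrix (Fin p) (Fin q) ℂ) : sigma1 M = ‖M‖ := rfl

lemma exists_GK {n ν : ℕ} (E : Matrix (Fin n) (Fin n) ℝ) (U : Matrix (Fin n) (Fin ν) ℝ)
    (hν : ν = n - E.rank) (hU : U.rank = ν) (hUE : Uᵀ * E = 0) :
    ∃ (G : Matrix (Fin n) (Fin n) ℝ) (K : Matrix (Fin n) (Fin ν) ℝ), E * G + K * Uᵀ = 1 := by
  have hr : E.rank ≤ n := E.rank_le_width
  have h1 : (Uᵀ * U).rank = ν := by rw [rank_transpose_mul_self, hU]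
  have hsurj : Function.Surjective (Uᵀ * U).mulVecLin := by
    rw [← LinearMap.range_eq_top]
    apply Submodule.eq_top_of_finrank_eq
    rw [← Matrix.rank, h1]; simp
  have hunit : IsUnit (Uᵀ * U) := Matrix.mulVec_surjective_iff_isUnit.mp hsurj
  have hdet : IsUnit (Uᵀ * U).det := (Matrix.isUnit_iff_isUnit_det _).mp hunit
  have hle : LinearMap.range E.mulVecLin ≤ LinearMap.ker Uᵀ.mulVecLin := by
    rintro _ ⟨x, rfl⟩
    rw [LinearMap.mem_ker, Matrix.mulVecLin_apply, Matrix.mulVecLin_apply, Matrix.mulVec_mulVec, hUE,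
      Matrix.zero_mulVec]
  have hfr : Module.finrank ℝ (LinearMap.range E.mulVecLin)
      = Module.finrank ℝ (LinearMap.ker Uᵀ.mulVecLin) := by
    have h2 := LinearMap.finrank_range_add_finrank_ker Uᵀ.mulVecLin
    rw [← Matrix.rank, rank_transpose, hU] at h2
    simp only [Module.finrank_fintype_fun_eq_card, Fintype.card_fin] at h2
    rw [← Matrix.rank]
    omega
  have heq := Submodule.eq_of_le_of_finrank_eq hle hfr
  set Q : Matrix (Fin n) (Fin n) ℝ := 1 - U * (Uᵀ * U)⁻¹ * Uᵀ with hQ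
  have hUQ : Uᵀ * Q = 0 := by
    have : Uᵀ * Q = Uᵀ - (Uᵀ * U) * (Uᵀ * U)⁻¹ * Uᵀ := by
      rw [hQ, Matrix.mul_sub, Matrix.mul_one]; simp only [Matrix.mul_assoc]
    rw [this, Matrix.mul_nonsing_inv _ hdet, Matrix.one_mul, sub_self]
  have hcol : ∀ k : Fin n, ∃ x : Fin n → ℝ, E *ᵥ x = fun i => Q i k := by
    intro k
    have : (fun i => Q i k) ∈ LinearMap.range E.mulVecLin := by
      rw [heq, LinearMap.mem_ker]
      ext i
      exact congrFun (congrFun hUQ i) k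
    obtain ⟨x, hx⟩ := this
    exact ⟨x, hx⟩
  choose g hg using hcol
  refine ⟨Matrix.of fun i k => g k i, U * (Uᵀ * U)⁻¹, ?_⟩
  have : E * (Matrix.of fun i k => g k i) = Q := by
    ext i k
    exact congrFun (hg k) i
  rw [this, hQ]; simp

lemma core_id {n ν : ℕ} (E S R G : Matrix (Fin n) (Fin n) ℂ) (Ut : Matrix (Fin ν) (Fin n) ℂ)
    (V K : Matrix (Fin n) (Fin ν) ℂ) (Si : Matrix (Fin ν) (Fin ν) ℂ) (l : ℂ) (hl : l ≠ 0)
    (hGK : E * G + K * Ut = 1) (hEV : E * V = 0) (hSi : (Ut * S * V) * Si = 1)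
    (hR : R * (l • E - S) = 1) :
    R + V * Si * Ut = l⁻¹ • ((1 + R * S) * (G * (1 - S * V * Si * Ut))) := by
  set P := 1 - S * V * Si * Ut with hP
  have hUP : Ut * P = 0 := by
    have : Ut * P = Ut - (Ut * S * V) * Si * Ut := by
      rw [hP, Matrix.mul_sub, Matrix.mul_one]; simp only [Matrix.mul_assoc]
    rw [this, hSi, Matrix.one_mul, sub_self]
  have hPE : E * (G * P) = P := by
    have : (E * G + K * Ut) * P = P := by rw [hGK, Matrix.one_mul]
    rw [Matrix.add_mul, Matrix.mul_assoc, Matrix.mul_assoc, hUP, Matrix.mul_zero, add_zero] at this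
    exact this
  have hRE : 1 + R * S = l • (R * E) := by
    rw [← hR, Matrix.mul_sub, Matrix.mul_smul, sub_add_cancel]
  have hRV : R * (S * V) = -V := by
    have h := congrArg (· * V) hR
    simp only [Matrix.mul_assoc, Matrix.sub_mul, Matrix.smul_mul, hEV, Matrix.one_mul, smul_zero,
      zero_sub, Matrix.mul_neg] at h
    exact neg_eq_iff_eq_neg.mp h
  rw [hRE, Matrix.smul_mul, smul_smul, inv_mul_cancel₀ hl, one_smul, Matrix.mul_assoc R E, hPE, hP,
    Matrix.mul_sub, Matrix.mul_one]
  have : R * (S * V * Si * Ut) = (R * (S * V)) * Si * Ut := by simp only [Matrix.mul_assoc]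
  rw [this, hRV]
  simp

/-- The matrix A0 + Σ A_i e^{-λ r_i}. -/
noncomputable def Smat {n m : ℕ} (A0 : Matrix (Fin n) (Fin n) ℝ)
    (A : Fin m → Matrix (Fin n) (Fin n) ℝ) (r : Fin m → ℝ) (lam : ℂ) :
    Matrix (Fin n) (Fin n) ℂ :=
  A0.map Complex.ofReal + ∑ i, Complex.exp (-lam * (r i : ℂ)) • (A i).map Complex.ofReal

lemma map_mul_c {p q r : ℕ} (M : Matrix (Fin p) (Fin q) ℝ) (N : Matrix (Fin q) (Fin r) ℝ) :
    (M * N).map Complex.ofReal = M.map Complex.ofReal * N.map Complex.ofReal :=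
  Matrix.map_mul (f := Complex.ofRealHom)

lemma DeltaA_eq {n m ν : ℕ} (A0 : Matrix (Fin n) (Fin n) ℝ)
    (A : Fin m → Matrix (Fin n) (Fin n) ℝ)
    (U V : Matrix (Fin n) (Fin ν) ℝ) (r : Fin m → ℝ) (lam : ℂ) :
    DeltaA A0 A U V r lam
      = Uᵀ.map Complex.ofReal * Smat A0 A r lam * V.map Complex.ofReal := by
  simp only [DeltaA, Smat, map_mul_c, Matrix.mul_add, Matrix.add_mul, 
    Matrix.mul_sum, Matrix.sum_mul, Matrix.mul_smul, Matrix.smul_mul]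

lemma Smat_bound {n m : ℕ} (A0 : Matrix (Fin n) (Fin n) ℝ)
    (A : Fin m → Matrix (Fin n) (Fin n) ℝ) (r : Fin m → ℝ) (ω : ℝ) :
    ‖Smat A0 A r (Complex.I * (ω : ℂ))‖
      ≤ ‖A0.map Complex.ofReal‖ + ∑ i, ‖(A i).map Complex.ofReal‖ := by
  refine (norm_add_le _ _).trans (add_le_add le_rfl ?_)
  refine (norm_sum_le _ _).trans (Finset.sum_le_sum fun i _ => ?_)
  rw [norm_smul]
  have : ‖Complex.exp (-(Complex.I * (ω : ℂ)) * (r i : ℂ))‖ = 1 := by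
    rw [Complex.norm_exp]; simp
  rw [this, one_mul]

lemma core_bound {n ν : ℕ} (G : Matrix (Fin n) (Fin n) ℂ) (Ut : Matrix (Fin ν) (Fin n) ℂ)
    (V : Matrix (Fin n) (Fin ν) ℂ) (s b : ℝ) (hs : 0 ≤ s) (hb : 0 ≤ b) :
    ∃ D Ω : ℝ, 0 ≤ D ∧ 0 < Ω ∧ ∀ (R S : Matrix (Fin n) (Fin n) ℂ) (Si : Matrix (Fin ν) (Fin ν) ℂ)
      (ω : ℝ) (l : ℂ), Ω < ω → ‖l‖ = ω → ‖S‖ ≤ s → ‖Si‖ ≤ b →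
      R + V * Si * Ut = l⁻¹ • ((1 + R * S) * (G * (1 - S * V * Si * Ut))) →
      ‖R + V * Si * Ut‖ ≤ D / ω := by
  set c := ‖(1 : Matrix (Fin n) (Fin n) ℂ)‖ with hc
  have hc0 : 0 ≤ c := norm_nonneg _
  set q := ‖V‖ * b * ‖Ut‖ with hq
  have hq0 : 0 ≤ q := by positivity
  set a := ‖G‖ * (c + s * ‖V‖ * b * ‖Ut‖) with ha
  have ha0 : 0 ≤ a := by positivity
  clear_value c q a
  refine ⟨(c + 2 * (q + c * a) * s) * a, 2 * s * a + 1, by positivity, by positivity, ?_⟩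
  intro R S Si ω l hω hl hS hSi hid
  have hω1 : 1 ≤ ω := by nlinarith [mul_nonneg hs ha0]
  have hω0 : 0 < ω := by linarith
  have hQ : ‖V * Si * Ut‖ ≤ q :=
    (l2_opNorm_mul _ _).trans (by
      rw [hq]
      refine mul_le_mul_of_nonneg_right ((l2_opNorm_mul _ _).trans ?_) (norm_nonneg _)
      gcongr)
  have hP : ‖G * (1 - S * V * Si * Ut)‖ ≤ a := by
    rw [ha]
    refine (l2_opNorm_mul _ _).trans (mul_le_mul_of_nonneg_left ?_ (norm_nonneg _))
    refine (norm_sub_le _ _).trans (add_le_add hc.ge ?_)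
    refine (l2_opNorm_mul _ _).trans (mul_le_mul_of_nonneg_right ?_ (norm_nonneg _))
    refine (l2_opNorm_mul _ _).trans (mul_le_mul ?_ hSi (norm_nonneg _) (by positivity))
    refine (l2_opNorm_mul _ _).trans (mul_le_mul_of_nonneg_right hS (norm_nonneg _))
  have hmain : ‖R + V * Si * Ut‖ ≤ (c + ‖R‖ * s) * a / ω := by
    rw [hid, norm_smul, norm_inv, hl, div_eq_inv_mul]
    refine mul_le_mul_of_nonneg_left ?_ (by positivity)
    refine (l2_opNorm_mul _ _).trans (mul_le_mul ?_ hP (norm_nonneg _) (by positivity))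
    refine (norm_add_le _ _).trans (add_le_add hc.ge ?_)
    exact (l2_opNorm_mul _ _).trans (mul_le_mul_of_nonneg_left hS (norm_nonneg _))
  have hR0 : ‖R‖ ≤ ‖R + V * Si * Ut‖ + ‖V * Si * Ut‖ := by
    have := norm_sub_le (R + V * Si * Ut) (V * Si * Ut)
    rwa [add_sub_cancel_right] at this
  have hsplit : (c + ‖R‖ * s) * a / ω ≤ c * a + ‖R‖ / 2 := by
    rw [div_le_iff₀ hω0]
    have h1 : c * a ≤ c * a * ω := le_mul_of_one_le_right (by positivity) hω1
    have h2 : ‖R‖ * (2 * s * a) ≤ ‖R‖ * ω :=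
      mul_le_mul_of_nonneg_left (by linarith) (norm_nonneg _)
    nlinarith
  have hR : ‖R‖ ≤ 2 * (q + c * a) := by linarith
  refine hmain.trans ?_
  gcongr

end helpers

theorem stmt0 (n m n_w n_z ν : ℕ)
    (E A0 : Matrix (Fin n) (Fin n) ℝ) (A : Fin m → Matrix (Fin n) (Fin n) ℝ)
    (B : Matrix (Fin n) (Fin n_w) ℝ) (C : Matrix (Fin n_z) (Fin n) ℝ)
    (U V : Matrix (Fin n) (Fin ν) ℝ)
    (hν : ν = n - E.rank) (hU : U.rank = ν) (hV : V.rank = ν)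
    (hUE : Uᵀ * E = 0) (hEV : E * V = 0)
    (τ : Fin m → ℝ) (hτ : ∀ i, 0 < τ i)
    (hinv : ∀ lam : ℂ, 0 ≤ lam.re → IsUnit (Delta E A0 A τ lam))
    (hinva : ∀ lam : ℂ, 0 ≤ lam.re → IsUnit (DeltaA A0 A U V τ lam))
    (hbdd : ∃ Mb : ℝ, ∀ lam : ℂ, 0 ≤ lam.re →
      sigma1 ((DeltaA A0 A U V τ lam)⁻¹) ≤ Mb) :
    ∀ γ : ℝ, 0 < γ → ∃ Ω : ℝ, 0 < Ω ∧ ∀ ω : ℝ, Ω < ω →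
      sigma1 (Ttf E A0 A B C τ (Complex.I * (ω : ℂ))
        - Ta A0 A B C U V τ (Complex.I * (ω : ℂ))) < γ := by
  intro γ hγ
  obtain ⟨G, K, hGK⟩ := exists_GK E U hν hU hUE
  obtain ⟨Mb, hMb⟩ := hbdd
  obtain ⟨D, Ω, hD, hΩ, hmain⟩ := core_bound (G.map Complex.ofReal) (Uᵀ.map Complex.ofReal)
    (V.map Complex.ofReal)
    (sigma1 (A0.map Complex.ofReal) + ∑ i, sigma1 ((A i).map Complex.ofReal)) (max Mb 0)
    (add_nonneg (norm_nonneg _) (Finset.sum_nonneg fun i _ => norm_nonneg _)) (le_max_right _ _)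
  set c := sigma1 (C.map Complex.ofReal) with hc
  set b := sigma1 (B.map Complex.ofReal) with hb
  have hc0 : 0 ≤ c := norm_nonneg _
  have hb0 : 0 ≤ b := norm_nonneg _
  refine ⟨max Ω (c * D * b / γ), lt_max_of_lt_left hΩ, fun ω hω => ?_⟩
  have hω1 : Ω < ω := (le_max_left _ _).trans_lt hω
  have hω2 : c * D * b / γ < ω := (le_max_right _ _).trans_lt hω
  have hω0 : 0 < ω := hΩ.trans hω1
  set l : ℂ := Complex.I * (ω : ℂ) with hl
  have hlre : 0 ≤ l.re := by simp [hl]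
  have hln : ‖l‖ = ω := by simp [hl, abs_of_pos hω0]
  have hl0 : l ≠ 0 := by
    rw [← norm_pos_iff, hln]; exact hω0
  have hDS : Delta E A0 A τ l = l • E.map Complex.ofReal - Smat A0 A τ l := by
    simp only [Delta, Smat]; abel
  have hdet := (Matrix.isUnit_iff_isUnit_det _).mp (hinv l hlre)
  have hdeta := (Matrix.isUnit_iff_isUnit_det _).mp (hinva l hlre)
  have hid := core_id (E.map Complex.ofReal) (Smat A0 A τ l) (Delta E A0 A τ l)⁻¹
    (G.map Complex.ofReal) (Uᵀ.map Complex.ofReal) (V.map Complex.ofReal) (K.map Complex.ofReal)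
    (DeltaA A0 A U V τ l)⁻¹ l hl0
    (by
      rw [← map_mul_c, ← map_mul_c, ← Matrix.map_add _ Complex.ofReal_add, hGK]
      exact Matrix.map_one _ Complex.ofReal_zero Complex.ofReal_one)
    (by rw [← map_mul_c, hEV]; exact Matrix.map_zero _ Complex.ofReal_zero)
    (by rw [← DeltaA_eq]; exact Matrix.mul_nonsing_inv _ hdeta)
    (by rw [← hDS]; exact Matrix.nonsing_inv_mul _ hdet)
  have hle := hmain _ _ _ ω l hω1 hln (Smat_bound A0 A τ ω)
    ((hMb l hlre).trans (le_max_left _ _)) hid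
  have hdiff : Ttf E A0 A B C τ l - Ta A0 A B C U V τ l
      = C.map Complex.ofReal * ((Delta E A0 A τ l)⁻¹ + V.map Complex.ofReal *
        (DeltaA A0 A U V τ l)⁻¹ * Uᵀ.map Complex.ofReal) * B.map Complex.ofReal := by
    simp only [Ttf, Ta, map_mul_c, sub_neg_eq_add, Matrix.mul_add, Matrix.add_mul,
      Matrix.mul_assoc]
  rw [hdiff]
  have h3 : c * (D / ω) * b < γ := by
    rw [div_lt_iff₀ hγ] at hω2
    rw [mul_div_assoc', div_mul_eq_mul_div, div_lt_iff₀ hω0]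
    linarith
  refine lt_of_le_of_lt ?_ h3
  refine (l2_opNorm_mul _ _).trans (mul_le_mul_of_nonneg_right ?_ hb0)
  exact (l2_opNorm_mul _ _).trans (mul_le_mul_of_nonneg_left hle hc0)
end

section
/- Assume the matrix Uᵀ A0 V + Σ_{i=1}^m Uᵀ A_i V e^{−jθ_i} is invertible for every θ = (θ1,...,θm) ∈ [0, 2π]^m. Then for every delay vector τ ∈ (ℝ⁺₀)^m the strong H∞ norm of T_a satisfies ⦀T_a(j·, τ)⦀∞ = max_{θ ∈ [0, 2π]^m} σ1(𝕋_a(θ)). -/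
open Matrix

theorem aux_exp_shift (x : ℝ) (k : ℤ) :
    Complex.exp (-Complex.I * ((x + 2 * Real.pi * k : ℝ) : ℂ)) = Complex.exp (-Complex.I * (x : ℂ)) := by
  rw [Complex.exp_eq_exp_iff_exists_int]
  refine ⟨-k, ?_⟩
  push_cast
  ring

theorem aux_TaBar_shift {n m ν n_w n_z : ℕ} (A0 : Matrix (Fin n) (Fin n) ℝ)
    (A : Fin m → Matrix (Fin n) (Fin n) ℝ)
    (B : Matrix (Fin n) (Fin n_w) ℝ) (C : Matrix (Fin n_z) (Fin n) ℝ)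
    (U V : Matrix (Fin n) (Fin ν) ℝ) (θ : Fin m → ℝ) (k : Fin m → ℤ) :
    TaBar A0 A B C U V (fun i => θ i + 2 * Real.pi * k i) = TaBar A0 A B C U V θ := by
  unfold TaBar ABar
  simp only [aux_exp_shift]

theorem aux_Ta {n m ν n_w n_z : ℕ} (A0 : Matrix (Fin n) (Fin n) ℝ)
    (A : Fin m → Matrix (Fin n) (Fin n) ℝ)
    (B : Matrix (Fin n) (Fin n_w) ℝ) (C : Matrix (Fin n_z) (Fin n) ℝ)
    (U V : Matrix (Fin n) (Fin ν) ℝ) (r : Fin m → ℝ) (ω : ℝ) :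
    Ta A0 A B C U V r (Complex.I * (ω : ℂ)) = TaBar A0 A B C U V (fun i => ω * r i) := by
  unfold Ta TaBar ABar DeltaA
  simp only [Complex.ofReal_mul, neg_mul, mul_assoc]

theorem aux_sigma1_continuous {p q : ℕ} :
    Continuous (sigma1 : Matrix (Fin p) (Fin q) ℂ → ℝ) := by
  unfold sigma1
  refine continuous_norm.comp ?_
  exact LinearMap.continuous_of_finiteDimensional
    ((LinearMap.toContinuousLinearMap (𝕜 := ℂ) (E := EuclideanSpace ℂ (Fin q))
      (F' := EuclideanSpace ℂ (Fin p))).toLinearMap ∘ₗ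
      (Matrix.toEuclideanLin (𝕜 := ℂ) (m := Fin p) (n := Fin q)).toLinearMap)

theorem aux_bdd {n m ν n_w n_z : ℕ} (A0 : Matrix (Fin n) (Fin n) ℝ)
    (A : Fin m → Matrix (Fin n) (Fin n) ℝ)
    (B : Matrix (Fin n) (Fin n_w) ℝ) (C : Matrix (Fin n_z) (Fin n) ℝ)
    (U V : Matrix (Fin n) (Fin ν) ℝ)
    (hθ : ∀ θ : Fin m → ℝ, (∀ i, θ i ∈ Set.Icc (0 : ℝ) (2 * Real.pi)) →
      IsUnit (ABar A0 A U V θ)) :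
    BddAbove (Set.range fun θ : {θ : Fin m → ℝ // ∀ i, θ i ∈ Set.Icc (0 : ℝ) (2 * Real.pi)} =>
      sigma1 (TaBar A0 A B C U V θ.1)) := by
  have hc : IsCompact {θ : Fin m → ℝ | ∀ i, θ i ∈ Set.Icc (0 : ℝ) (2 * Real.pi)} := by
    have := isCompact_univ_pi (fun _ : Fin m => isCompact_Icc (a := (0:ℝ)) (b := 2 * Real.pi))
    simpa [Set.pi] using this
  haveI : CompactSpace {θ : Fin m → ℝ // ∀ i, θ i ∈ Set.Icc (0 : ℝ) (2 * Real.pi)} :=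
    isCompact_iff_compactSpace.mp hc
  have hA : Continuous fun θ : {θ : Fin m → ℝ // ∀ i, θ i ∈ Set.Icc (0 : ℝ) (2 * Real.pi)} =>
      ABar A0 A U V θ.1 := by
    unfold ABar
    refine continuous_const.add (continuous_finsetSum _ fun i _ => Continuous.fun_smul ?_ continuous_const)
    exact Complex.continuous_exp.comp (continuous_const.mul
      (Complex.continuous_ofReal.comp ((continuous_apply i).comp continuous_subtype_val)))
  have hinv : Continuous fun θ : {θ : Fin m → ℝ // ∀ i, θ i ∈ Set.Icc (0 : ℝ) (2 * Real.pi)} =>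
      (ABar A0 A U V θ.1)⁻¹ := by
    simp only [Matrix.inv_def, Ring.inverse_eq_inv']
    refine Continuous.smul (Continuous.inv₀ hA.matrix_det ?_) hA.matrix_adjugate
    intro θ
    exact ((Matrix.isUnit_iff_isUnit_det _).mp (hθ θ.1 θ.2)).ne_zero
  refine (isCompact_range ?_).bddAbove
  refine aux_sigma1_continuous.comp ?_
  unfold TaBar
  exact ((continuous_const.matrix_mul hinv).matrix_mul continuous_const).neg

theorem aux_sigma1_nonneg {p q : ℕ} (M : Matrix (Fin p) (Fin q) ℂ) : 0 ≤ sigma1 M :=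
  norm_nonneg _

theorem stmt1 (n m n_w n_z ν : ℕ)
    (E A0 : Matrix (Fin n) (Fin n) ℝ) (A : Fin m → Matrix (Fin n) (Fin n) ℝ)
    (B : Matrix (Fin n) (Fin n_w) ℝ) (C : Matrix (Fin n_z) (Fin n) ℝ)
    (U V : Matrix (Fin n) (Fin ν) ℝ)
    (hν : ν = n - E.rank) (hU : U.rank = ν) (hV : V.rank = ν)
    (hUE : Uᵀ * E = 0) (hEV : E * V = 0)
    (hθ : ∀ θ : Fin m → ℝ, (∀ i, θ i ∈ Set.Icc (0 : ℝ) (2 * Real.pi)) →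
      IsUnit (ABar A0 A U V θ)) :
    ∀ τ : Fin m → ℝ, (∀ i, 0 < τ i) →
      strongVal (fun r => ⨆ ω : ℝ, sigma1 (Ta A0 A B C U V r (Complex.I * (ω : ℂ)))) τ
        = (⨆ θ : {θ : Fin m → ℝ // ∀ i, θ i ∈ Set.Icc (0 : ℝ) (2 * Real.pi)},
      sigma1 (TaBar A0 A B C U V θ.1)) := by
  intro τ hτ
  have hpi := Real.pi_pos
  have hbdd := aux_bdd A0 A B C U V hθ
  set M := ⨆ θ : {θ : Fin m → ℝ // ∀ i, θ i ∈ Set.Icc (0 : ℝ) (2 * Real.pi)},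
      sigma1 (TaBar A0 A B C U V θ.1) with hM
  have hM0 : 0 ≤ M := Real.iSup_nonneg fun θ => aux_sigma1_nonneg _
  have hle : ∀ θ : Fin m → ℝ, sigma1 (TaBar A0 A B C U V θ) ≤ M := by
    intro θ
    have hp : (0:ℝ) < 2 * Real.pi := by positivity
    let k : Fin m → ℤ := fun i => -⌊θ i / (2 * Real.pi)⌋
    rw [← aux_TaBar_shift A0 A B C U V θ k]
    refine le_ciSup hbdd ⟨fun i => θ i + 2 * Real.pi * k i, fun i => ?_⟩
    have h1 := Int.floor_le (θ i / (2 * Real.pi))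
    have h2 := Int.lt_floor_add_one (θ i / (2 * Real.pi))
    rw [le_div_iff₀ hp] at h1
    rw [div_lt_iff₀ hp] at h2
    simp only [k, Int.cast_neg]
    constructor <;> nlinarith
  simp only [aux_Ta]
  have hHle : ∀ r : Fin m → ℝ,
      (⨆ ω : ℝ, sigma1 (TaBar A0 A B C U V fun i => ω * r i)) ≤ M :=
    fun r => ciSup_le fun ω => hle _
  have hH0 : ∀ r : Fin m → ℝ,
      0 ≤ (⨆ ω : ℝ, sigma1 (TaBar A0 A B C U V fun i => ω * r i)) :=
    fun r => Real.iSup_nonneg fun ω => aux_sigma1_nonneg _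
  unfold strongVal
  haveI : Nonempty {e : ℝ // 0 < e} := ⟨⟨1, one_pos⟩⟩
  apply le_antisymm
  · refine (ciInf_le ⟨0, ?_⟩ (⟨1, one_pos⟩ : {e : ℝ // 0 < e})).trans ?_
    · rintro _ ⟨ε, rfl⟩
      refine Real.sSup_nonneg ?_
      rintro x ⟨r, -, -, rfl⟩
      exact hH0 r
    · refine Real.sSup_le ?_ hM0
      rintro x ⟨r, -, -, rfl⟩
      exact hHle r
  · refine le_ciInf fun ε => ?_
    haveI : Nonempty {θ : Fin m → ℝ // ∀ i, θ i ∈ Set.Icc (0 : ℝ) (2 * Real.pi)} :=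
      ⟨⟨fun _ => 0, fun _ => ⟨le_rfl, by positivity⟩⟩⟩
    refine ciSup_le ?_
    rintro ⟨θ, hθ'⟩
    obtain ⟨ε, hε⟩ := ε
    have hm : (0:ℝ) < (m:ℝ) + 1 := by positivity
    obtain ⟨ω, hω⟩ : ∃ ω : ℝ, ω = 4 * Real.pi * (m + 1) / ε := ⟨_, rfl⟩
    have hω0 : 0 < ω := by rw [hω]; positivity
    let k : Fin m → ℤ := fun i => ⌈ω * τ i / (2 * Real.pi)⌉
    let r : Fin m → ℝ := fun i => (θ i + 2 * Real.pi * k i) / ω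
    have hp : (0:ℝ) < 2 * Real.pi := by positivity
    have hr : ∀ i, τ i ≤ r i ∧ r i - τ i ≤ ε / (m + 1) := by
      intro i
      have h1 := Int.le_ceil (ω * τ i / (2 * Real.pi))
      have h2 := Int.ceil_lt_add_one (ω * τ i / (2 * Real.pi))
      rw [div_le_iff₀ hp] at h1
      rw [← sub_lt_iff_lt_add, lt_div_iff₀ hp] at h2
      have h3 := hθ' i
      have h4 : ε / (m + 1) = 4 * Real.pi / ω := by rw [hω]; field_simp
      simp only [r]
      constructor
      · rw [le_div_iff₀ hω0]; simp only [k]; nlinarith [h3.1]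
      · rw [h4, sub_le_iff_le_add, div_le_iff₀ hω0, add_mul, div_mul_cancel₀ _ hω0.ne']
        simp only [k]; nlinarith [h3.2]
    have hwr : TaBar A0 A B C U V θ = TaBar A0 A B C U V (fun i => ω * r i) := by
      rw [← aux_TaBar_shift A0 A B C U V θ k]
      congr 1
      funext i
      simp only [r]
      field_simp
    have hmem : (∑ i, (r i - τ i) ^ 2) < ε ^ 2 := by
      calc (∑ i, (r i - τ i) ^ 2) ≤ ∑ i : Fin m, (ε / (m + 1)) ^ 2 := by
            refine Finset.sum_le_sum fun i _ => ?_
            have := hr i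
            exact pow_le_pow_left₀ (by linarith) this.2 2
        _ = m * (ε / (m + 1)) ^ 2 := by simp
        _ < ε ^ 2 := by
            rw [div_pow, mul_div_assoc', div_lt_iff₀ (by positivity)]
            have : 0 < ε ^ 2 := by positivity
            nlinarith [(Nat.cast_nonneg m : (0:ℝ) ≤ m), mul_nonneg this.le (Nat.cast_nonneg m : (0:ℝ) ≤ m), mul_nonneg this.le (sq_nonneg (m:ℝ))]
    have h1 : sigma1 (TaBar A0 A B C U V θ) ≤
        ⨆ ω : ℝ, sigma1 (TaBar A0 A B C U V fun i => ω * r i) := by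
      rw [hwr]
      refine le_ciSup (f := fun ω : ℝ => sigma1 (TaBar A0 A B C U V fun i => ω * r i)) ⟨M, ?_⟩ ω
      rintro _ ⟨w, rfl⟩
      exact hle _
    refine h1.trans (le_csSup ⟨M, ?_⟩ ⟨r, hmem, fun i => (hτ i).trans_le (hr i).1, rfl⟩)
    rintro x ⟨r, -, -, rfl⟩
    exact hHle r
end

section
/- Assume the matrix Uᵀ A0 V + Σ_{i=1}^m Uᵀ A_i V e^{−jθ_i} is invertible for every θ = (θ1,...,θm) ∈ [0, 2π]^m. If the delays τ1,...,τm are rationally independent, then ⦀T_a(j·, τ)⦀∞ = ‖T_a(j·, τ)‖∞. -/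
open Matrix

theorem kron_aux {m : ℕ} (τ : Fin m → ℝ)
    (hind : ∀ z : Fin m → ℤ, (∑ i, (z i : ℝ) * τ i) = 0 → ∀ i, z i = 0) :
    DenseRange (fun t : ℝ => (fun i => ((t * τ i : ℝ) : UnitAddCircle) : UnitAddTorus (Fin m))) := by
  set γ : ℝ → UnitAddTorus (Fin m) := fun t i => ((t * τ i : ℝ) : UnitAddCircle) with hγ
  set μ : MeasureTheory.Measure (UnitAddTorus (Fin m)) :=
    MeasureTheory.Measure.pi (fun _ : Fin m => (AddCircle.haarAddCircle (T := (1:ℝ)))) with hμ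
  have h1d : ∀ k : ℤ, k ≠ 0 →
      ∫ x, (fourier k x : ℂ) ∂(AddCircle.haarAddCircle (T := (1:ℝ))) = 0 := by
    intro k hk
    have := (orthonormal_iff_ite.1 (orthonormal_fourier (T := (1:ℝ)))) 0 k
    rw [if_neg (Ne.symm hk), MeasureTheory.ContinuousMap.inner_toLp] at this
    rw [← this]
    simp
  have hγc : Continuous γ := by
    refine continuous_pi fun i => ?_
    exact (AddCircle.continuous_mk' 1).comp (continuous_id.mul continuous_const)
  -- averages of trigonometric polynomials
  have hP : ∀ g ∈ Submodule.span ℂ (Set.range (UnitAddTorus.mFourier (d := Fin m))),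
      Filter.Tendsto (fun T : ℝ => (T : ℂ)⁻¹ * ∫ t in (0:ℝ)..T, g (γ t)) Filter.atTop
        (nhds (∫ x, g x ∂μ)) := by
    intro g hg
    induction hg using Submodule.span_induction with
    | mem g hg =>
      obtain ⟨z, rfl⟩ := hg
      have hval : ∀ t, UnitAddTorus.mFourier z (γ t)
          = Complex.exp ((2 * Real.pi * Complex.I * ((∑ i, (z i : ℝ) * τ i : ℝ) : ℂ)) * t) := by
        intro t
        simp only [UnitAddTorus.mFourier, ContinuousMap.coe_mk, hγ]
        simp only [fourier_coe_apply]
        rw [← Complex.exp_sum]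
        congr 1
        push_cast
        rw [Finset.mul_sum, Finset.sum_mul]
        refine Finset.sum_congr rfl fun i _ => ?_
        ring
      by_cases hz : z = 0
      · subst hz
        have h1 : (∫ x : UnitAddTorus (Fin m), UnitAddTorus.mFourier (0 : Fin m → ℤ) x ∂μ) = 1 := by
          simp [UnitAddTorus.mFourier_zero]
        rw [h1]
        refine tendsto_const_nhds.congr' ?_
        filter_upwards [Filter.eventually_gt_atTop 0] with T hT
        have : (T : ℂ) ≠ 0 := by exact_mod_cast hT.ne'
        simp [UnitAddTorus.mFourier_zero, this]
      · have h0 : (∫ x : UnitAddTorus (Fin m), UnitAddTorus.mFourier z x ∂μ) = 0 := by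
          obtain ⟨i, hi⟩ := Function.ne_iff.mp hz
          simp only [UnitAddTorus.mFourier, ContinuousMap.coe_mk, hμ]
          have hp := MeasureTheory.integral_fintype_prod_eq_prod (𝕜 := ℂ)
            (μ := fun _ : Fin m => (AddCircle.haarAddCircle (T := (1:ℝ))))
            (fun i x => (fourier (z i) x : ℂ))
          refine hp.trans ?_
          exact Finset.prod_eq_zero (Finset.mem_univ i) (h1d _ hi)
        rw [h0]
        set s : ℝ := ∑ i, (z i : ℝ) * τ i with hs
        have hs0 : s ≠ 0 := fun h => hz (funext fun i => hind z h i)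
        set c : ℂ := 2 * Real.pi * Complex.I * (s : ℂ) with hc
        have hc0 : c ≠ 0 := by
          simp [hc, hs0, Real.pi_ne_zero]
        have hint : ∀ T : ℝ, (∫ t in (0:ℝ)..T, UnitAddTorus.mFourier z (γ t))
            = (Complex.exp (c * T) - 1) / c := by
          intro T
          simp_rw [hval]
          rw [integral_exp_mul_complex hc0]
          simp
        simp_rw [hint]
        rw [tendsto_zero_iff_norm_tendsto_zero]
        have hlim : Filter.Tendsto (fun T : ℝ => T⁻¹ * (2 / ‖c‖)) Filter.atTop (nhds 0) := by
          simpa using tendsto_inv_atTop_zero.mul_const (2 / ‖c‖)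
        refine tendsto_of_tendsto_of_tendsto_of_le_of_le' tendsto_const_nhds hlim
          (Filter.Eventually.of_forall fun T => norm_nonneg _) ?_
        filter_upwards [Filter.eventually_gt_atTop 0] with T hT
        rw [norm_mul, norm_div, norm_inv, Complex.norm_real, Real.norm_of_nonneg hT.le]
        gcongr
        have he : ‖Complex.exp (c * T)‖ = 1 := by
          have : c * T = ((2 * Real.pi * s * T : ℝ) : ℂ) * Complex.I := by
            rw [hc]; push_cast; ring
          rw [this, Complex.norm_exp_ofReal_mul_I]
        calc ‖Complex.exp (c * T) - 1‖ ≤ ‖Complex.exp (c * T)‖ + ‖(1:ℂ)‖ := norm_sub_le _ _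
          _ = 2 := by rw [he]; norm_num
    | zero => simp
    | add f g _ _ hf hg =>
      have hi : ∀ f : C(UnitAddTorus (Fin m), ℂ), MeasureTheory.Integrable (fun x => f x) μ := fun f =>
        f.continuous.integrable_of_hasCompactSupport (HasCompactSupport.of_compactSpace _)
      have hii : ∀ (f : C(UnitAddTorus (Fin m), ℂ)) (T : ℝ),
          IntervalIntegrable (fun t => f (γ t)) MeasureTheory.volume 0 T := fun f T =>
        (f.continuous.comp hγc).intervalIntegrable _ _
      simp only [ContinuousMap.add_apply]
      rw [MeasureTheory.integral_add (hi f) (hi g)]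
      refine (hf.add hg).congr fun T => ?_
      rw [intervalIntegral.integral_add (hii f T) (hii g T), mul_add]
    | smul a f _ hf =>
      simp only [ContinuousMap.smul_apply, smul_eq_mul]
      rw [MeasureTheory.integral_const_mul]
      refine (hf.const_mul a).congr fun T => ?_
      rw [intervalIntegral.integral_const_mul]
      ring
  by_contra hnd
  rw [DenseRange, dense_iff_closure_eq] at hnd
  obtain ⟨x0, hx0⟩ := (Set.ne_univ_iff_exists_notMem _).1 hnd
  obtain ⟨f, hf0, hf1, hf01⟩ := exists_continuous_zero_one_of_isClosed
    (isClosed_closure (s := Set.range γ)) (isClosed_singleton (x := x0))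
    (Set.disjoint_singleton_right.2 hx0)
  have hfi : MeasureTheory.Integrable (fun x => f x) μ :=
        f.continuous.integrable_of_hasCompactSupport (HasCompactSupport.of_compactSpace _)
  have hpos : 0 < ∫ x, f x ∂μ := by
    refine f.continuous.integral_pos_of_hasCompactSupport_nonneg_nonzero
      (HasCompactSupport.of_compactSpace _) (fun x => (hf01 x).1) (x := x0) ?_
    rw [hf1 rfl]; exact one_ne_zero
  set I := ∫ x, f x ∂μ with hI
  let fc : C(UnitAddTorus (Fin m), ℂ) := ⟨fun x => (f x : ℂ), by fun_prop⟩
  have hfc : ∫ x, fc x ∂μ = (I : ℂ) := by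
    rw [hI]; exact integral_ofReal
  have hmem : fc ∈ closure
      (Submodule.span ℂ (Set.range (UnitAddTorus.mFourier (d := Fin m))) :
        Set C(UnitAddTorus (Fin m), ℂ)) := by
    rw [← Submodule.topologicalClosure_coe, UnitAddTorus.span_mFourier_closure_eq_top]
    trivial
  obtain ⟨g, hg, hfg⟩ := Metric.mem_closure_iff.1 hmem (I / 3) (by positivity)
  have hd : ∀ x, ‖fc x - g x‖ ≤ I / 3 := fun x => by
    rw [← dist_eq_norm]
    exact (ContinuousMap.dist_apply_le_dist x).trans hfg.le
  have hgi : ∀ f : C(UnitAddTorus (Fin m), ℂ), MeasureTheory.Integrable (fun x => f x) μ := fun f =>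
        f.continuous.integrable_of_hasCompactSupport (HasCompactSupport.of_compactSpace _)
  have h1 : ‖∫ x, g x ∂μ‖ ≤ I / 3 := by
    refine le_of_tendsto (hP g hg).norm ?_
    filter_upwards [Filter.eventually_gt_atTop 0] with T hT
    have hb : ‖∫ t in (0:ℝ)..T, g (γ t)‖ ≤ I / 3 * |T - 0| := by
      refine intervalIntegral.norm_integral_le_of_norm_le_const fun t _ => ?_
      have h := hd (γ t)
      have h' : fc (γ t) = 0 := by
        have : f (γ t) = 0 := hf0 (subset_closure ⟨t, rfl⟩)
        simp [fc, this]
      rwa [h', zero_sub, norm_neg] at h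
    rw [sub_zero, abs_of_pos hT] at hb
    rw [norm_mul, norm_inv, Complex.norm_real, Real.norm_of_nonneg hT.le]
    calc T⁻¹ * _ ≤ T⁻¹ * (I / 3 * T) := by gcongr
      _ = I / 3 := by field_simp
  have h2 : ‖(∫ x, fc x ∂μ) - ∫ x, g x ∂μ‖ ≤ I / 3 := by
    rw [← MeasureTheory.integral_sub (hgi fc) (hgi g)]
    have := MeasureTheory.norm_integral_le_of_norm_le_const
      (μ := μ)
      (Filter.Eventually.of_forall hd)
    simpa using this
  have h3 : ‖∫ x, fc x ∂μ‖ = I := by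
    rw [hfc, Complex.norm_real, Real.norm_of_nonneg hpos.le]
  have h4 := norm_sub_norm_le (∫ x, fc x ∂μ) (∫ x, g x ∂μ)
  linarith

theorem sigma1_cont {p q : ℕ} : Continuous (sigma1 (p := p) (q := q)) := by
  unfold sigma1
  refine continuous_norm.comp ?_
  exact LinearMap.continuous_of_finiteDimensional
    ((LinearMap.toContinuousLinearMap.toLinearMap).comp
      (Matrix.toEuclideanLin (𝕜 := ℂ) (m := Fin p) (n := Fin q)).toLinearMap)

theorem stmt3 (n m n_w n_z ν : ℕ)
    (E A0 : Matrix (Fin n) (Fin n) ℝ) (A : Fin m → Matrix (Fin n) (Fin n) ℝ)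
    (B : Matrix (Fin n) (Fin n_w) ℝ) (C : Matrix (Fin n_z) (Fin n) ℝ)
    (U V : Matrix (Fin n) (Fin ν) ℝ)
    (hν : ν = n - E.rank) (hU : U.rank = ν) (hV : V.rank = ν)
    (hUE : Uᵀ * E = 0) (hEV : E * V = 0)
    (τ : Fin m → ℝ) (hτ : ∀ i, 0 < τ i)
    (hθ : ∀ θ : Fin m → ℝ, (∀ i, θ i ∈ Set.Icc (0 : ℝ) (2 * Real.pi)) →
      IsUnit (ABar A0 A U V θ))
    (hind : ∀ z : Fin m → ℤ, (∑ i, (z i : ℝ) * τ i) = 0 → ∀ i, z i = 0) :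
    strongVal (fun r => ⨆ ω : ℝ, sigma1 (Ta A0 A B C U V r (Complex.I * (ω : ℂ)))) τ
      = (⨆ ω : ℝ, sigma1 (Ta A0 A B C U V τ (Complex.I * (ω : ℂ)))) := by
  classical
  let D : UnitAddTorus (Fin m) → Matrix (Fin ν) (Fin ν) ℂ := fun x =>
    (Uᵀ * A0 * V).map Complex.ofReal
      + ∑ i, (fourier (-1) (x i) : ℂ) • (Uᵀ * A i * V).map Complex.ofReal
  let G : UnitAddTorus (Fin m) → ℝ := fun x =>
    sigma1 (-((C * V).map Complex.ofReal * (D x)⁻¹ * (Uᵀ * B).map Complex.ofReal))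
  have hD : Continuous D := by
    refine continuous_const.add (continuous_finsetSum _ fun i _ => ?_)
    exact ((fourier (-1)).continuous.comp (continuous_apply i)).smul continuous_const
  have hdet : ∀ x, (D x).det ≠ 0 := by
    intro x
    have hx : ∀ i, ∃ t : ℝ, t ∈ Set.Ico (0:ℝ) 1 ∧ (t : UnitAddCircle) = x i := by
      intro i
      have := AddCircle.coe_image_Ico_eq (p := (1:ℝ)) 0
      have h2 : x i ∈ ((↑) : ℝ → AddCircle (1:ℝ)) '' Set.Ico 0 (0 + 1) := by
        rw [this]; trivial
      obtain ⟨t, ht, h⟩ := h2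
      exact ⟨t, by simpa using ht, h⟩
    choose t ht htx using hx
    have hu := hθ (fun i => 2 * Real.pi * t i) (fun i => by
      have := Real.pi_pos
      obtain ⟨h0, h1⟩ := ht i
      constructor
      · positivity
      · nlinarith)
    have he : D x = ABar A0 A U V (fun i => 2 * Real.pi * t i) := by
      simp only [D, ABar]
      congr 1
      refine Finset.sum_congr rfl fun i _ => ?_
      rw [← htx i]
      congr 1
      rw [fourier_coe_apply]
      congr 1
      push_cast
      ring
    rw [he]
    exact ((Matrix.isUnit_iff_isUnit_det _).1 hu).ne_zero
  have hG : Continuous G := by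
    refine sigma1_cont.comp (Continuous.neg ?_)
    refine Continuous.matrix_mul (Continuous.matrix_mul continuous_const ?_) continuous_const
    simp only [Matrix.inv_def, Ring.inverse_eq_inv']
    exact (hD.matrix_det.inv₀ hdet).smul hD.matrix_adjugate
  have hbdd : BddAbove (Set.range G) := (isCompact_range hG).bddAbove
  have hTa : ∀ (r : Fin m → ℝ) (ω : ℝ), sigma1 (Ta A0 A B C U V r (Complex.I * (ω : ℂ)))
      = G (fun i => ((ω / (2 * Real.pi) * r i : ℝ) : UnitAddCircle)) := by
    intro r ω
    have he : DeltaA A0 A U V r (Complex.I * (ω : ℂ))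
        = D (fun i => ((ω / (2 * Real.pi) * r i : ℝ) : UnitAddCircle)) := by
      simp only [D, DeltaA]
      congr 1
      refine Finset.sum_congr rfl fun i _ => ?_
      congr 1
      rw [fourier_coe_apply]
      congr 1
      have : (Real.pi : ℂ) ≠ 0 := by exact_mod_cast Real.pi_ne_zero
      push_cast
      field_simp
    simp only [Ta, G, he]
  simp only [hTa]
  set S : ℝ := ⨆ ω : ℝ, G (fun i => ((ω / (2 * Real.pi) * τ i : ℝ) : UnitAddCircle)) with hS
  have hle : ∀ x, G x ≤ S := by
    intro x
    refine (kron_aux τ hind).induction_on (p := fun x => G x ≤ S) x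
      (isClosed_le hG continuous_const) fun t => ?_
    have hb : BddAbove (Set.range fun ω : ℝ =>
        G (fun i => ((ω / (2 * Real.pi) * τ i : ℝ) : UnitAddCircle))) :=
      hbdd.mono (by rintro _ ⟨ω, rfl⟩; exact ⟨_, rfl⟩)
    have := le_ciSup hb (2 * Real.pi * t)
    have h2 : 2 * Real.pi * t / (2 * Real.pi) = t := by
      have := Real.pi_ne_zero
      field_simp
    simpa only [h2] using this
  unfold strongVal
  have hsup : ∀ ε : {e : ℝ // 0 < e}, sSup {x : ℝ | ∃ r : Fin m → ℝ,
      (∑ i, (r i - τ i) ^ 2) < (ε : ℝ) ^ 2 ∧ (∀ i, 0 < r i) ∧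
        x = ⨆ ω : ℝ, G (fun i => ((ω / (2 * Real.pi) * r i : ℝ) : UnitAddCircle))} = S := by
    intro ε
    refine IsGreatest.csSup_eq ⟨⟨τ, ?_, hτ, rfl⟩, ?_⟩
    · have := ε.2
      simp only [sub_self]
      simp
      positivity
    · rintro _ ⟨r, _, _, rfl⟩
      exact ciSup_le fun ω => hle _
  haveI : Nonempty {e : ℝ // 0 < e} := ⟨⟨1, one_pos⟩⟩
  simp only [hsup]
  exact ciInf_const
end

section
/- Assume the matrix Uᵀ A0 V + Σ_{i=1}^m Uᵀ A_i V e^{−jθ_i} is invertible for every θ = (θ1,...,θm) ∈ [0, 2π]^m. If the delays τ1,...,τm are rationally independent, then ‖T_a(j·, τ)‖∞ = max_{θ ∈ [0, 2π]^m} σ1(𝕋_a(θ)). -/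
open Matrix

open MeasureTheory Filter Topology in
lemma kron_mean {m : ℕ} (a : Fin m → ℝ)
    (ha : ∀ z : Fin m → ℤ, (∑ i, (z i : ℝ) * a i) = 0 → ∀ i, z i = 0)
    (μ : Measure (UnitAddTorus (Fin m))) [IsProbabilityMeasure μ] [μ.IsAddLeftInvariant]
    (f : C(UnitAddTorus (Fin m), ℂ))
    (hf : f ∈ Submodule.span ℂ (Set.range (UnitAddTorus.mFourier (d := Fin m)))) :
    Tendsto (fun T : ℝ => (T : ℂ)⁻¹ * ∫ t in (0:ℝ)..T, f (fun i => ((t * a i : ℝ) : UnitAddCircle)))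
      atTop (𝓝 (∫ x, f x ∂μ)) := by
  have hγ : Continuous (fun t : ℝ => (fun i => ((t * a i : ℝ) : UnitAddCircle) :
      UnitAddTorus (Fin m))) := by
    refine continuous_pi fun i => ?_
    exact (AddCircle.continuous_mk' 1).comp (by fun_prop)
  induction hf using Submodule.span_induction with
  | mem f hf =>
    obtain ⟨z, rfl⟩ := hf
    by_cases hz : z = 0
    · subst hz
      simp only [UnitAddTorus.mFourier_zero, ContinuousMap.one_apply]
      apply tendsto_const_nhds.congr'
      filter_upwards [eventually_gt_atTop 0] with T hT
      simp [hT.ne']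
    · set c : ℂ := 2 * Real.pi * Complex.I * ((∑ i, (z i : ℝ) * a i : ℝ) : ℂ) with hc
      have hs : (∑ i, (z i : ℝ) * a i) ≠ 0 := fun h => hz (funext (ha z h))
      have hc0 : c ≠ 0 := by
        rw [hc]
        exact mul_ne_zero Complex.two_pi_I_ne_zero (by exact_mod_cast hs)
      have hval : ∀ t : ℝ, UnitAddTorus.mFourier z (fun i => ((t * a i : ℝ) : UnitAddCircle))
          = Complex.exp (c * t) := by
        intro t
        simp only [UnitAddTorus.mFourier, ContinuousMap.coe_mk, fourier_coe_apply]
        rw [← Complex.exp_sum]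
        congr 1
        rw [hc]
        push_cast
        rw [Finset.mul_sum, Finset.sum_mul]
        refine Finset.sum_congr rfl fun i _ => ?_
        ring
      have hnorm : ∀ t : ℝ, ‖Complex.exp (c * t)‖ = 1 := by
        intro t
        rw [Complex.norm_exp]
        simp [hc]
      have hint : ∫ x, UnitAddTorus.mFourier z x ∂μ = 0 := by
        set S : ℝ := ∑ i, (z i : ℝ) * a i
        have h1 := integral_add_left_eq_self (μ := μ) (UnitAddTorus.mFourier z)
          (fun i => (((1 / (2 * S)) * a i : ℝ) : UnitAddCircle))
        have h2 : ∀ x y, UnitAddTorus.mFourier z (x + y)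
            = UnitAddTorus.mFourier z x * UnitAddTorus.mFourier z y := by
          intro x y
          simp only [UnitAddTorus.mFourier, ContinuousMap.coe_mk, ← Finset.prod_mul_distrib]
          refine Finset.prod_congr rfl fun i _ => ?_
          simp [fourier_apply, smul_add, AddCircle.toCircle_add]
        simp only [h2] at h1
        rw [integral_const_mul, hval] at h1
        have h3 : Complex.exp (c * ((1 / (2 * S) : ℝ) : ℂ)) = -1 := by
          rw [← Complex.exp_pi_mul_I]
          congr 1
          have : (S : ℂ) ≠ 0 := by exact_mod_cast hs
          rw [hc]
          push_cast
          field_simp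
        rw [h3] at h1
        have : (2 : ℂ) * ∫ x, UnitAddTorus.mFourier z x ∂μ = 0 := by linear_combination -h1
        simpa using this
      rw [hint]
      simp only [hval]
      simp only [integral_exp_mul_complex hc0]
      have hb : ∀ T : ℝ, ‖(Complex.exp (c * T) - Complex.exp (c * (0:ℝ))) / c‖ ≤ 2 / ‖c‖ := by
        intro T
        rw [norm_div]
        gcongr
        refine (norm_sub_le _ _).trans ?_
        rw [hnorm, hnorm]; norm_num
      have h0 : Tendsto (fun T : ℝ => T⁻¹ * (2 / ‖c‖)) atTop (𝓝 0) := by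
        simpa using tendsto_inv_atTop_zero.mul_const (2 / ‖c‖)
      refine squeeze_zero_norm' ?_ h0
      filter_upwards [eventually_gt_atTop 0] with T hT
      rw [norm_mul, norm_inv, Complex.norm_real, Real.norm_of_nonneg hT.le]
      exact mul_le_mul_of_nonneg_left (hb T) (by positivity)
  | zero => simp
  | add f g _ _ hf hg =>
    have hfi : Integrable f μ := BoundedContinuousFunction.integrable μ
      (BoundedContinuousFunction.mkOfCompact f)
    have hgi : Integrable g μ := BoundedContinuousFunction.integrable μ
      (BoundedContinuousFunction.mkOfCompact g)
    simp only [ContinuousMap.add_apply]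
    rw [integral_add hfi hgi]
    refine (hf.add hg).congr fun T => ?_
    have h := intervalIntegral.integral_add (μ := volume) (a := 0) (b := T)
      ((f.continuous.comp hγ).intervalIntegrable _ _) ((g.continuous.comp hγ).intervalIntegrable _ _)
    simp only [Function.comp_apply] at h
    rw [h]
    ring
  | smul k f _ hf =>
    simp only [ContinuousMap.smul_apply, smul_eq_mul]
    rw [integral_const_mul]
    refine (hf.const_mul k).congr fun T => ?_
    rw [intervalIntegral.integral_const_mul]
    ring

open MeasureTheory Filter Topology in
lemma kron_dense {m : ℕ} (a : Fin m → ℝ)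
    (ha : ∀ z : Fin m → ℤ, (∑ i, (z i : ℝ) * a i) = 0 → ∀ i, z i = 0) :
    DenseRange (fun t : ℝ => (fun i => ((t * a i : ℝ) : UnitAddCircle) : UnitAddTorus (Fin m))) := by
  set γ := (fun t : ℝ => (fun i => ((t * a i : ℝ) : UnitAddCircle) : UnitAddTorus (Fin m))) with hγ
  let μ : Measure (UnitAddTorus (Fin m)) := Measure.pi (fun _ => AddCircle.haarAddCircle)
  have : IsProbabilityMeasure μ := by dsimp only [μ]; infer_instance
  have : μ.IsAddLeftInvariant := by dsimp only [μ]; infer_instance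
  have : μ.IsOpenPosMeasure := by dsimp only [μ]; infer_instance
  intro x
  by_contra hx
  let F : C(UnitAddTorus (Fin m), ℝ) :=
    ⟨fun y => Metric.infDist y (Set.range γ), Metric.continuous_infDist_pt _⟩
  let f : C(UnitAddTorus (Fin m), ℂ) := ⟨fun y => (F y : ℂ), by fun_prop⟩
  have hne : (Set.range γ).Nonempty := Set.range_nonempty _
  have hpos : 0 < ∫ y, F y ∂μ := by
    refine Continuous.integral_pos_of_hasCompactSupport_nonneg_nonzero (x := x) F.continuous
      (HasCompactSupport.of_compactSpace _) (fun y => Metric.infDist_nonneg) ?_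
    intro h
    exact hx ((Metric.mem_closure_iff_infDist_zero hne).2 h)
  set I := ∫ y, F y ∂μ
  have hfI : ∫ y, f y ∂μ = (I : ℂ) := integral_ofReal
  have hmem : f ∈ closure (Submodule.span ℂ (Set.range (UnitAddTorus.mFourier (d := Fin m))) :
      Set C(UnitAddTorus (Fin m), ℂ)) := by
    rw [← Submodule.topologicalClosure_coe, UnitAddTorus.span_mFourier_closure_eq_top]
    trivial
  obtain ⟨P, hP, hd⟩ := Metric.mem_closure_iff.1 hmem (I / 4) (by positivity)
  have hle : ∀ y, ‖f y - P y‖ ≤ I / 4 := fun y => by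
    rw [← dist_eq_norm]
    exact (ContinuousMap.dist_apply_le_dist y).trans hd.le
  have hlim := kron_mean a ha μ P hP
  have hb : ‖∫ y, P y ∂μ‖ ≤ I / 4 := by
    refine le_of_tendsto hlim.norm ?_
    filter_upwards [eventually_gt_atTop 0] with T hT
    rw [norm_mul, norm_inv, Complex.norm_real, Real.norm_of_nonneg hT.le]
    have h1 : ‖∫ t in (0:ℝ)..T, P (γ t)‖ ≤ (I / 4) * |T - 0| := by
      refine intervalIntegral.norm_integral_le_of_norm_le_const fun t _ => ?_
      have h2 := hle (γ t)
      have h3 : f (γ t) = 0 := by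
        have : F (γ t) = 0 := Metric.infDist_zero_of_mem ⟨t, rfl⟩
        change ((F (γ t) : ℝ) : ℂ) = 0
        rw [this]; simp
      rwa [h3, zero_sub, norm_neg] at h2
    rw [sub_zero, abs_of_pos hT] at h1
    calc T⁻¹ * _ ≤ T⁻¹ * (I / 4 * T) := mul_le_mul_of_nonneg_left h1 (by positivity)
      _ = I / 4 := by field_simp
  have hfi : Integrable f μ := BoundedContinuousFunction.integrable μ
    (BoundedContinuousFunction.mkOfCompact f)
  have hPi : Integrable P μ := BoundedContinuousFunction.integrable μ
    (BoundedContinuousFunction.mkOfCompact P)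
  have hdiff : ‖(∫ y, f y ∂μ) - ∫ y, P y ∂μ‖ ≤ I / 4 := by
    rw [← integral_sub hfi hPi]
    refine (norm_integral_le_of_norm_le_const (Eventually.of_forall hle)).trans ?_
    simp
  have : ‖∫ y, f y ∂μ‖ ≤ I / 4 + I / 4 := by
    have := norm_add_le ((∫ y, f y ∂μ) - ∫ y, P y ∂μ) (∫ y, P y ∂μ)
    rw [sub_add_cancel] at this
    linarith
  rw [hfI, Complex.norm_real, Real.norm_of_nonneg hpos.le] at this
  linarith

lemma ABar_periodic {n m ν : ℕ} (A0 : Matrix (Fin n) (Fin n) ℝ)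
    (A : Fin m → Matrix (Fin n) (Fin n) ℝ)
    (U V : Matrix (Fin n) (Fin ν) ℝ) (θ θ' : Fin m → ℝ) (k : Fin m → ℤ)
    (h : ∀ i, θ i = θ' i + k i * (2 * Real.pi)) : ABar A0 A U V θ = ABar A0 A U V θ' := by
  unfold ABar
  congr 1
  refine Finset.sum_congr rfl fun i _ => ?_
  congr 1
  rw [Complex.exp_eq_exp_iff_exists_int]
  refine ⟨-k i, ?_⟩
  rw [h i]
  push_cast
  ring

lemma ABar_reduce {m : ℕ} (θ : Fin m → ℝ) : ∃ (θ' : Fin m → ℝ) (k : Fin m → ℤ),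
    (∀ i, θ' i ∈ Set.Icc (0 : ℝ) (2 * Real.pi)) ∧ ∀ i, θ i = θ' i + k i * (2 * Real.pi) := by
  refine ⟨fun i => toIcoMod Real.two_pi_pos 0 (θ i), fun i => toIcoDiv Real.two_pi_pos 0 (θ i),
    fun i => ?_, fun i => ?_⟩
  · have := toIcoMod_mem_Ico Real.two_pi_pos 0 (θ i)
    rw [zero_add] at this
    exact Set.Ico_subset_Icc_self this
  · have := toIcoMod_add_toIcoDiv_zsmul Real.two_pi_pos 0 (θ i)
    simpa using this.symm

lemma sigma1_continuous {p q : ℕ} :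
    Continuous (fun M : Matrix (Fin p) (Fin q) ℂ => sigma1 M) := by
  unfold sigma1
  refine continuous_norm.comp ?_
  exact LinearMap.continuous_of_finiteDimensional
    ((LinearMap.toContinuousLinearMap (𝕜 := ℂ) (E := EuclideanSpace ℂ (Fin q))
      (F' := EuclideanSpace ℂ (Fin p))).toLinearMap ∘ₗ
      (Matrix.toEuclideanLin (𝕜 := ℂ) (m := Fin p) (n := Fin q)).toLinearMap)

theorem stmt5 (n m n_w n_z ν : ℕ)
    (E A0 : Matrix (Fin n) (Fin n) ℝ) (A : Fin m → Matrix (Fin n) (Fin n) ℝ)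
    (B : Matrix (Fin n) (Fin n_w) ℝ) (C : Matrix (Fin n_z) (Fin n) ℝ)
    (U V : Matrix (Fin n) (Fin ν) ℝ)
    (hν : ν = n - E.rank) (hU : U.rank = ν) (hV : V.rank = ν)
    (hUE : Uᵀ * E = 0) (hEV : E * V = 0)
    (τ : Fin m → ℝ) (hτ : ∀ i, 0 < τ i)
    (hθ : ∀ θ : Fin m → ℝ, (∀ i, θ i ∈ Set.Icc (0 : ℝ) (2 * Real.pi)) →
      IsUnit (ABar A0 A U V θ))
    (hind : ∀ z : Fin m → ℤ, (∑ i, (z i : ℝ) * τ i) = 0 → ∀ i, z i = 0) :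
    (⨆ ω : ℝ, sigma1 (Ta A0 A B C U V τ (Complex.I * (ω : ℂ))))
      = (⨆ θ : {θ : Fin m → ℝ // ∀ i, θ i ∈ Set.Icc (0 : ℝ) (2 * Real.pi)},
      sigma1 (TaBar A0 A B C U V θ.1)) := by
  have hunit : ∀ θ : Fin m → ℝ, IsUnit (ABar A0 A U V θ) := by
    intro θ
    obtain ⟨θ', k, h1, h2⟩ := ABar_reduce θ
    rw [ABar_periodic A0 A U V θ θ' k h2]
    exact hθ θ' h1
  have hper : ∀ (θ θ' : Fin m → ℝ) (k : Fin m → ℤ), (∀ i, θ i = θ' i + k i * (2 * Real.pi)) →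
      sigma1 (TaBar A0 A B C U V θ) = sigma1 (TaBar A0 A B C U V θ') := by
    intro θ θ' k h
    unfold TaBar
    rw [ABar_periodic A0 A U V θ θ' k h]
  have hcont : Continuous fun θ : Fin m → ℝ => sigma1 (TaBar A0 A B C U V θ) := by
    refine sigma1_continuous.comp ?_
    have hA : Continuous fun θ : Fin m → ℝ => ABar A0 A U V θ := by
      unfold ABar
      fun_prop
    have hAi : Continuous fun θ : Fin m → ℝ => (ABar A0 A U V θ)⁻¹ := by
      rw [continuous_iff_continuousAt]
      intro θ
      have hdet : (ABar A0 A U V θ).det ≠ 0 :=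
        ((Matrix.isUnit_iff_isUnit_det _).1 (hunit θ)).ne_zero
      have h1 : ContinuousAt Ring.inverse (ABar A0 A U V θ).det := by
        rw [Ring.inverse_eq_inv']
        exact continuousAt_inv₀ hdet
      exact ContinuousAt.comp (f := fun θ => ABar A0 A U V θ)
        (continuousAt_matrix_inv _ h1) hA.continuousAt
    unfold TaBar
    exact ((continuous_const.matrix_mul hAi).matrix_mul continuous_const).neg
  have hTa : ∀ ω : ℝ, Ta A0 A B C U V τ (Complex.I * (ω : ℂ))
      = TaBar A0 A B C U V (fun i => ω * τ i) := by
    intro ω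
    have : DeltaA A0 A U V τ (Complex.I * (ω : ℂ)) = ABar A0 A U V (fun i => ω * τ i) := by
      unfold DeltaA ABar
      congr 1
      refine Finset.sum_congr rfl fun i _ => ?_
      congr 2
      push_cast
      ring
    unfold Ta TaBar
    rw [this]
  simp only [hTa]
  have hbdd : BddAbove (Set.range fun θ : {θ : Fin m → ℝ // ∀ i, θ i ∈ Set.Icc (0 : ℝ) (2 * Real.pi)} =>
      sigma1 (TaBar A0 A B C U V θ.1)) := by
    have hK : IsCompact (Set.pi Set.univ fun _ : Fin m => Set.Icc (0 : ℝ) (2 * Real.pi)) :=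
      isCompact_univ_pi fun _ => isCompact_Icc
    obtain ⟨b, hb⟩ := (hK.image hcont).bddAbove
    refine ⟨b, ?_⟩
    rintro _ ⟨θ, rfl⟩
    exact hb ⟨θ.1, fun i _ => θ.2 i, rfl⟩
  have hle : ∀ ω : ℝ, sigma1 (TaBar A0 A B C U V (fun i => ω * τ i)) ≤
      ⨆ θ : {θ : Fin m → ℝ // ∀ i, θ i ∈ Set.Icc (0 : ℝ) (2 * Real.pi)},
      sigma1 (TaBar A0 A B C U V θ.1) := by
    intro ω
    obtain ⟨θ', k, h1, h2⟩ := ABar_reduce (fun i => ω * τ i)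
    rw [hper _ θ' k h2]
    exact le_ciSup hbdd ⟨θ', h1⟩
  have hbdd' : BddAbove (Set.range fun ω : ℝ => sigma1 (TaBar A0 A B C U V (fun i => ω * τ i))) :=
    ⟨_, by rintro _ ⟨ω, rfl⟩; exact hle ω⟩
  have : Nonempty {θ : Fin m → ℝ // ∀ i, θ i ∈ Set.Icc (0 : ℝ) (2 * Real.pi)} :=
    ⟨⟨fun _ => 0, fun _ => ⟨le_rfl, Real.two_pi_pos.le⟩⟩⟩
  refine le_antisymm (ciSup_le hle) (ciSup_le fun θ => ?_)
  refine le_of_forall_lt fun c hc => ?_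
  let O : Set (Fin m → ℝ) :=
    {x | c < sigma1 (TaBar A0 A B C U V (fun i => 2 * Real.pi * x i))}
  have hO : IsOpen O := isOpen_lt continuous_const
    (hcont.comp (f := fun x : Fin m → ℝ => fun i => 2 * Real.pi * x i) (by fun_prop))
  have hmap : IsOpenMap (Pi.map (fun _ : Fin m => ((↑) : ℝ → UnitAddCircle))) :=
    IsOpenMap.piMap (fun _ => QuotientAddGroup.isOpenMap_coe) (by simp)
  have hx0 : (fun i => θ.1 i / (2 * Real.pi)) ∈ O := by
    change c < sigma1 (TaBar A0 A B C U V (fun i => 2 * Real.pi * (θ.1 i / (2 * Real.pi))))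
    have : (fun i => 2 * Real.pi * (θ.1 i / (2 * Real.pi))) = θ.1 := by
      funext i
      field_simp
    rwa [this]
  obtain ⟨t, x, hxO, hxt⟩ := (kron_dense τ hind).exists_mem_open (hmap O hO) ⟨_, _, hx0, rfl⟩
  have hk : ∀ i, ∃ k : ℤ, t * τ i = x i + k := by
    intro i
    have h1 : ((x i : ℝ) : UnitAddCircle) = ((t * τ i : ℝ) : UnitAddCircle) := congrFun hxt i
    have h2 : ((t * τ i - x i : ℝ) : UnitAddCircle) = 0 := by
      rw [AddCircle.coe_sub, h1, sub_self]
    obtain ⟨k, hk⟩ := (AddCircle.coe_eq_zero_iff (1:ℝ)).1 h2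
    refine ⟨k, ?_⟩
    simp at hk
    linarith
  choose k hk using hk
  refine lt_of_lt_of_le hxO ?_
  have := hper (fun i => (2 * Real.pi * t) * τ i) (fun i => 2 * Real.pi * x i) k (fun i => by
    have := hk i
    linear_combination (2 * Real.pi) * this)
  rw [← this]
  exact le_ciSup hbdd' (2 * Real.pi * t)
end

section
/- Fix ξ > 0, a delay vector r ∈ (ℝ⁺)^m, and ω ∈ ℝ such that the matrix jωE − A0 − Σ_{i=1}^m A_i e^{−jωr_i} is invertible. Then ξ is a singular value of T(jω, r) if and only if λ = jω is a zero of the function λ ↦ det of the 2n×2n block matrix [[λE − A0 − Σ_{i=1}^m A_i e^{−λr_i}, −ξ^{−1} B Bᵀ], [ξ^{−1} Cᵀ C, λEᵀ + A0ᵀ + Σ_{i=1}^m A_iᵀ e^{λr_i}]]. -/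
open Matrix

/-- the Hamiltonian-like 2n×2n matrix of the level-set characterization. -/
noncomputable def Ham {n m n_w n_z : ℕ} (E A0 : Matrix (Fin n) (Fin n) ℝ)
    (A : Fin m → Matrix (Fin n) (Fin n) ℝ)
    (B : Matrix (Fin n) (Fin n_w) ℝ) (C : Matrix (Fin n_z) (Fin n) ℝ)
    (r : Fin m → ℝ) (ξ : ℝ) (lam : ℂ) :
    Matrix (Fin n ⊕ Fin n) (Fin n ⊕ Fin n) ℂ :=
  Matrix.fromBlocks
    (Delta E A0 A r lam)
    (-((ξ : ℂ)⁻¹ • (B * Bᵀ).map Complex.ofReal))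
    ((ξ : ℂ)⁻¹ • (Cᵀ * C).map Complex.ofReal)
    (lam • Eᵀ.map Complex.ofReal + A0ᵀ.map Complex.ofReal
      + ∑ i, Complex.exp (lam * (r i : ℂ)) • (A i)ᵀ.map Complex.ofReal)

theorem aux_gen {n p q : ℕ} (D : Matrix (Fin n) (Fin n) ℂ) (b : Matrix (Fin n) (Fin q) ℂ)
    (c : Matrix (Fin p) (Fin n) ℂ) (s : ℂ) (hD : IsUnit D) :
    (Matrix.fromBlocks D (-(s • (b * bᴴ))) (s • (cᴴ * c)) (-Dᴴ)).det = 0 ↔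
      (1 - s ^ 2 • ((c * D⁻¹ * b)ᴴ * (c * D⁻¹ * b))).det = 0 := by
  have hd : IsUnit D.det := (Matrix.isUnit_iff_isUnit_det D).1 hD
  have hd' : IsUnit Dᴴ.det := by rw [Matrix.det_conjTranspose]; exact hd.star
  letI := Matrix.invertibleOfIsUnitDet D hd
  have key : -Dᴴ - s • (cᴴ * c) * ⅟D * (-(s • (b * bᴴ))) =
      (-Dᴴ) * (1 - (s ^ 2 • (Dᴴ⁻¹ * cᴴ * c * D⁻¹ * b)) * bᴴ) := by
    have h1 : Dᴴ * (Dᴴ⁻¹ * (cᴴ * (c * (D⁻¹ * (b * bᴴ))))) = cᴴ * (c * (D⁻¹ * (b * bᴴ))) :=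
      Matrix.mul_nonsing_inv_cancel_left Dᴴ _ hd'
    simp only [Matrix.invOf_eq_nonsing_inv, Matrix.mul_sub, Matrix.mul_one, Matrix.mul_neg,
      Matrix.neg_mul, Matrix.smul_mul, Matrix.mul_smul, Matrix.mul_assoc, h1, smul_smul, pow_two, smul_neg]
  have hdn : (-Dᴴ).det ≠ 0 := by
    rw [Matrix.det_neg]
    exact mul_ne_zero (pow_ne_zero _ (by norm_num)) hd'.ne_zero
  rw [Matrix.det_fromBlocks₁₁, key, Matrix.det_mul, Matrix.det_one_sub_mul_comm]
  simp only [mul_eq_zero, hd.ne_zero, hdn, false_or]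
  simp only [Matrix.conjTranspose_mul, Matrix.conjTranspose_nonsing_inv, Matrix.mul_smul,
    Matrix.mul_assoc]

theorem aux_map {p q : ℕ} (M : Matrix (Fin p) (Fin q) ℝ) :
    Mᵀ.map Complex.ofReal = (M.map Complex.ofReal)ᴴ := by
  ext i j
  simp

theorem aux_mul {p q k : ℕ} (M : Matrix (Fin p) (Fin q) ℝ) (N : Matrix (Fin q) (Fin k) ℝ) :
    (M * N).map Complex.ofReal = M.map Complex.ofReal * N.map Complex.ofReal :=
  Matrix.map_mul (f := Complex.ofRealHom)

theorem stmt11 (n m n_w n_z : ℕ)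
    (E A0 : Matrix (Fin n) (Fin n) ℝ) (A : Fin m → Matrix (Fin n) (Fin n) ℝ)
    (B : Matrix (Fin n) (Fin n_w) ℝ) (C : Matrix (Fin n_z) (Fin n) ℝ)
    (ξ : ℝ) (hξ : 0 < ξ)
    (r : Fin m → ℝ) (hr : ∀ i, 0 < r i)
    (ω : ℝ) (hinv : IsUnit (Delta E A0 A r (Complex.I * (ω : ℂ)))) :
    IsSingularValue (Ttf E A0 A B C r (Complex.I * (ω : ℂ))) ξ ↔
      (Ham E A0 A B C r ξ (Complex.I * (ω : ℂ))).det = 0 := by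
  have h22 : (Complex.I * (ω : ℂ)) • Eᵀ.map Complex.ofReal + A0ᵀ.map Complex.ofReal
      + ∑ i, Complex.exp ((Complex.I * (ω : ℂ)) * (r i : ℂ)) • (A i)ᵀ.map Complex.ofReal
      = -(Delta E A0 A r (Complex.I * (ω : ℂ)))ᴴ := by
    have he : ∀ i, star (Complex.exp (-(Complex.I * (ω : ℂ)) * (r i : ℂ))) =
        Complex.exp ((Complex.I * (ω : ℂ)) * (r i : ℂ)) := by
      intro i
      rw [Complex.star_def, ← Complex.exp_conj]
      simp
    have hl : star (Complex.I * (ω : ℂ)) = -(Complex.I * (ω : ℂ)) := by simp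
    simp only [Delta, Matrix.conjTranspose_sub, Matrix.conjTranspose_smul,
      Matrix.conjTranspose_sum, aux_map, he, hl, neg_smul]
    abel
  rw [Ham, h22, aux_mul, aux_mul, aux_map, aux_map, aux_gen _ _ _ _ hinv, ← Ttf,
    ← Matrix.exists_mulVec_eq_zero_iff, IsSingularValue]
  have hx : (ξ : ℂ) ≠ 0 := by exact_mod_cast hξ.ne'
  have hx2 : (ξ : ℂ) ^ 2 ≠ 0 := pow_ne_zero _ hx
  simp only [hξ.le, true_and, Matrix.sub_mulVec, Matrix.one_mulVec, Matrix.smul_mulVec,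
    sub_eq_zero, inv_pow]
  refine exists_congr fun v => and_congr_right fun _ => ?_
  rw [eq_comm, eq_inv_smul_iff₀ hx2]
end
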